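/- Weighted bound for the half-order Riesz potential: There exists a universal constant C > 0 such that for every measurable weight V : ℂ → (0,∞) with V ∈ L²(ℂ) and every g ∈ L²(ℂ) with g ≥ 0, one has ∫_ℂ (∫_ℂ g(ζ)/|ζ−z|^{3/2} dv_ζ)² V(z) dv_z ≤ C² ‖V‖_{L²(ℂ)} ‖g‖²_{L²(ℂ)}. Equivalently, ‖I_{1/2} g‖_{L²_V(ℂ)} ≤ C ‖V‖_{L²(ℂ)}^{1/2} ‖g‖_{L²(ℂ)}. -/

import Mathlib

open MeasureTheory

open Set in
/-- Integration of a radial function on `ℂ` in polar coordinates. -/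
lemma Complex.lintegral_fun_norm {f : ℝ → ENNReal} (hf : Measurable f) :
    ∫⁻ x : ℂ, f ‖x‖ = ENNReal.ofReal (2 * Real.pi) * ∫⁻ r in Ioi 0, ENNReal.ofReal r * f r := by
  rw [← Complex.lintegral_comp_polarCoord_symm, polarCoord_target, Measure.volume_eq_prod,
    ← Measure.prod_restrict]
  have h : ∀ᵐ p : ℝ × ℝ ∂((volume.restrict (Ioi 0)).prod
      (volume.restrict (Ioo (-Real.pi) Real.pi))),
      ENNReal.ofReal p.1 • f ‖Complex.polarCoord.symm p‖ =
        (ENNReal.ofReal p.1 * f p.1) * 1 := by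
    rw [Measure.prod_restrict]
    filter_upwards [ae_restrict_mem (measurableSet_Ioi.prod measurableSet_Ioo)] with p hp
    have hp0 : 0 < p.1 := hp.1
    rw [Complex.norm_polarCoord_symm, abs_of_pos hp0, smul_eq_mul, mul_one]
  rw [lintegral_congr_ae h, lintegral_prod_mul (f := fun r => ENNReal.ofReal r * f r)
    (g := fun _ => 1) (by fun_prop) (by fun_prop), mul_comm]
  congr 1
  rw [lintegral_one, Measure.restrict_apply_univ, Real.volume_Ioo]
  congr 1
  ring

/-- The radial profile `r ↦ r ^ (-3/2)` of the half-order Riesz kernel on `ℂ`. -/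
noncomputable def halfRieszProfile (r : ℝ) : ENNReal := ENNReal.ofReal (r ^ (3 / 2 : ℝ))⁻¹

lemma measurable_halfRieszProfile : Measurable halfRieszProfile := by
  unfold halfRieszProfile
  fun_prop

open Set in
lemma lintegral_halfRieszProfile_near {ρ : ℝ} (hρ : 0 < ρ) :
    ∫⁻ x : ℂ, (Iio (ρ ^ 2)).indicator halfRieszProfile ‖x‖ =
      ENNReal.ofReal (4 * Real.pi * ρ) := by
  rw [Complex.lintegral_fun_norm (measurable_halfRieszProfile.indicator measurableSet_Iio)]
  have hint : IntervalIntegrable (fun r : ℝ => r ^ (-1 / 2 : ℝ)) volume 0 (ρ ^ 2) :=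
    intervalIntegral.intervalIntegrable_rpow' (by norm_num)
  have h : ∫⁻ r in Ioi (0 : ℝ), ENNReal.ofReal r * (Iio (ρ ^ 2)).indicator halfRieszProfile r =
      ENNReal.ofReal (2 * ρ) := by
    calc _ = ∫⁻ r in Ioi (0 : ℝ), (Iio (ρ ^ 2)).indicator
            (fun r => ENNReal.ofReal (r ^ (-1 / 2 : ℝ))) r := by
          refine setLIntegral_congr_fun measurableSet_Ioi fun r (hr : 0 < r) => ?_
          by_cases hrR : r ∈ Iio (ρ ^ 2)
          · simp only [indicator_of_mem hrR, halfRieszProfile]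
            rw [← ENNReal.ofReal_mul hr.le, ← Real.rpow_neg hr.le, ← Real.rpow_one_add' hr.le]
            all_goals norm_num
          · simp [indicator_of_notMem hrR]
      _ = ∫⁻ r in Ioc 0 (ρ ^ 2), ENNReal.ofReal (r ^ (-1 / 2 : ℝ)) := by
          rw [lintegral_indicator measurableSet_Iio, Measure.restrict_restrict measurableSet_Iio,
            Iio_inter_Ioi]
          exact setLIntegral_congr Ioo_ae_eq_Ioc
      _ = ENNReal.ofReal (∫ r in (0 : ℝ)..ρ ^ 2, r ^ (-1 / 2 : ℝ)) := by
          rw [intervalIntegral.integral_of_le (by positivity),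
            ofReal_integral_eq_lintegral_ofReal hint.1]
          filter_upwards [ae_restrict_mem measurableSet_Ioc] with r hr
          exact Real.rpow_nonneg hr.1.le _
      _ = ENNReal.ofReal (2 * ρ) := by
          rw [integral_rpow (Or.inl (by norm_num))]
          congr 1
          rw [Real.zero_rpow (by norm_num), ← Real.rpow_natCast, ← Real.rpow_mul hρ.le]
          norm_num
          ring
  rw [h, ← ENNReal.ofReal_mul (by positivity)]
  congr 1
  ring

open Set in
lemma lintegral_sq_halfRieszProfile_far {ρ : ℝ} (hρ : 0 < ρ) :
    ∫⁻ x : ℂ, (Iio (ρ ^ 2))ᶜ.indicator halfRieszProfile ‖x‖ ^ 2 =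
      ENNReal.ofReal (2 * Real.pi / ρ ^ 2) := by
  rw [Complex.lintegral_fun_norm (f := fun r => (Iio (ρ ^ 2))ᶜ.indicator halfRieszProfile r ^ 2)
    ((measurable_halfRieszProfile.indicator measurableSet_Iio.compl).pow_const 2)]
  have hρ2 : 0 < ρ ^ 2 := by positivity
  have h : ∫⁻ r in Ioi (0 : ℝ),
      ENNReal.ofReal r * (Iio (ρ ^ 2))ᶜ.indicator halfRieszProfile r ^ 2 =
      ENNReal.ofReal (1 / ρ ^ 2) := by
    calc _ = ∫⁻ r in Ioi (0 : ℝ), (Ici (ρ ^ 2)).indicator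
            (fun r => ENNReal.ofReal (r ^ (-2 : ℝ))) r := by
          refine setLIntegral_congr_fun measurableSet_Ioi fun r (hr : 0 < r) => ?_
          rw [compl_Iio]
          by_cases hrR : r ∈ Ici (ρ ^ 2)
          · simp only [indicator_of_mem hrR, halfRieszProfile]
            rw [← ENNReal.ofReal_pow (by positivity), ← ENNReal.ofReal_mul hr.le,
              ← Real.rpow_neg hr.le, ← Real.rpow_natCast, ← Real.rpow_mul hr.le,
              ← Real.rpow_one_add' hr.le]
            all_goals norm_num
          · simp [indicator_of_notMem hrR]
      _ = ∫⁻ r in Ioi (ρ ^ 2), ENNReal.ofReal (r ^ (-2 : ℝ)) := by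
          rw [lintegral_indicator measurableSet_Ici, Measure.restrict_restrict measurableSet_Ici,
            inter_eq_left.2 (Ici_subset_Ioi.2 hρ2)]
          exact setLIntegral_congr Ioi_ae_eq_Ici.symm
      _ = ENNReal.ofReal (∫ r in Ioi (ρ ^ 2), r ^ (-2 : ℝ)) := by
          rw [ofReal_integral_eq_lintegral_ofReal (integrableOn_Ioi_rpow_of_lt (by norm_num) hρ2)]
          filter_upwards [ae_restrict_mem measurableSet_Ioi] with r hr
          exact Real.rpow_nonneg (hρ2.trans hr).le _
      _ = ENNReal.ofReal (1 / ρ ^ 2) := by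
          rw [integral_Ioi_rpow_of_lt (by norm_num) hρ2]
          congr 1
          norm_num [Real.rpow_neg_one]
  rw [h, ← ENNReal.ofReal_mul (by positivity)]
  congr 1
  ring

/-- The Riesz potential of order `1/2` of a nonnegative function on `ℂ`. -/
noncomputable def halfRieszPotential (G : ℂ → ENNReal) (z : ℂ) : ENNReal :=
  ∫⁻ ζ, G ζ * halfRieszProfile (dist ζ z)

lemma measurable_halfRieszPotential {G : ℂ → ENNReal} (hG : Measurable G) :
    Measurable (halfRieszPotential G) := by
  have h := measurable_halfRieszProfile
  unfold halfRieszPotential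
  exact Measurable.lintegral_prod_right' (f := fun p : ℂ × ℂ => G p.2 *
    halfRieszProfile (dist p.2 p.1)) (by fun_prop)

lemma ENNReal.lintegral_mul_sq_le {α : Type*} [MeasurableSpace α] (μ : Measure α)
    {f g : α → ENNReal} (hf : AEMeasurable f μ) (hg : AEMeasurable g μ) :
    ∫⁻ a, f a * g a ∂μ ≤
      (∫⁻ a, f a ^ 2 ∂μ) ^ (1 / 2 : ℝ) * (∫⁻ a, g a ^ 2 ∂μ) ^ (1 / 2 : ℝ) := by
  simpa using ENNReal.lintegral_mul_le_Lp_mul_Lq μ Real.HolderConjugate.two_two hf hg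

open Set in
/-- Distributional estimate for the half-order Riesz potential: only the large values of `G`
contribute to a superlevel set. -/
lemma volume_lt_halfRieszPotential_le {G : ℂ → ENNReal} (hG : Measurable G) {N t : ℝ}
    (hN : 0 < N) (hGN : ∫⁻ z, G z ^ 2 ≤ ENNReal.ofReal (N ^ 2)) (ht : 0 < t) :
    volume {z | ENNReal.ofReal (3 * t) < halfRieszPotential G z} ≤
      ENNReal.ofReal (40 * N / t ^ 2) *
        ∫⁻ ζ, {ζ | ENNReal.ofReal (t ^ 2 / (40 * N)) < G ζ}.indicator G ζ := by
  set ρ := 3 * N / t with hρ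
  have hρ0 : 0 < ρ := by positivity
  set S := {ζ | ENNReal.ofReal (t ^ 2 / (40 * N)) < G ζ} with hS
  have hSm : MeasurableSet S := measurableSet_lt measurable_const hG
  set kn := (Iio (ρ ^ 2)).indicator halfRieszProfile with hkn
  set kf := (Iio (ρ ^ 2))ᶜ.indicator halfRieszProfile with hkf
  have hknm : Measurable kn := measurable_halfRieszProfile.indicator measurableSet_Iio
  have hkfm : Measurable kf := measurable_halfRieszProfile.indicator measurableSet_Iio.compl
  have hSG : Measurable (S.indicator G) := hG.indicator hSm
  have hknint : ∫⁻ x : ℂ, kn ‖x‖ ≤ ENNReal.ofReal (40 * N / t) := by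
    rw [hkn, lintegral_halfRieszProfile_near hρ0]
    apply ENNReal.ofReal_le_ofReal
    rw [hρ, mul_div_assoc', div_le_div_iff_of_pos_right ht]
    nlinarith [Real.pi_lt_d2]
  set F : ℂ → ENNReal := fun z => ∫⁻ ζ, S.indicator G ζ * kn (dist ζ z) with hF
  have hFm : Measurable F :=
    Measurable.lintegral_prod_right' (f := fun p : ℂ × ℂ => S.indicator G p.2 *
      kn (dist p.2 p.1)) (by fun_prop)
  have hfar (z : ℂ) : ∫⁻ ζ, G ζ * kf (dist ζ z) ≤ ENNReal.ofReal t := by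
    refine (ENNReal.lintegral_mul_sq_le volume hG.aemeasurable (by fun_prop)).trans ?_
    have h1 : ∫⁻ ζ, kf (dist ζ z) ^ 2 = ENNReal.ofReal (2 * Real.pi / ρ ^ 2) := by
      simp_rw [dist_eq_norm]
      rw [lintegral_sub_right_eq_self (fun x : ℂ => kf ‖x‖ ^ 2) z]
      exact lintegral_sq_halfRieszProfile_far hρ0
    rw [h1, ← ENNReal.mul_rpow_of_nonneg _ _ (by norm_num)]
    have h2 : (∫⁻ z, G z ^ 2) * ENNReal.ofReal (2 * Real.pi / ρ ^ 2) ≤ ENNReal.ofReal t ^ 2 := by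
      refine (mul_le_mul_left hGN _).trans ?_
      rw [← ENNReal.ofReal_mul (by positivity), ← ENNReal.ofReal_pow ht.le]
      apply ENNReal.ofReal_le_ofReal
      rw [hρ]
      field_simp
      nlinarith [Real.pi_lt_d2]
    refine (ENNReal.rpow_le_rpow h2 (by norm_num)).trans_eq ?_
    rw [← ENNReal.rpow_natCast, ← ENNReal.rpow_mul]
    norm_num
  have hsmall (z : ℂ) : ∫⁻ ζ, Sᶜ.indicator G ζ * kn (dist ζ z) ≤ ENNReal.ofReal t := by
    calc _ ≤ ∫⁻ ζ, ENNReal.ofReal (t ^ 2 / (40 * N)) * kn (dist ζ z) := by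
          refine lintegral_mono fun ζ => mul_le_mul_left ?_ _
          by_cases h : ζ ∈ S
          · simp [h]
          · simpa [h] using not_lt.1 h
      _ = ENNReal.ofReal (t ^ 2 / (40 * N)) * ∫⁻ x : ℂ, kn ‖x‖ := by
          rw [lintegral_const_mul _ (by fun_prop)]
          simp_rw [dist_eq_norm]
          rw [lintegral_sub_right_eq_self (fun x : ℂ => kn ‖x‖) z]
      _ ≤ ENNReal.ofReal (t ^ 2 / (40 * N)) * ENNReal.ofReal (40 * N / t) := by gcongr
      _ = ENNReal.ofReal t := by
          rw [← ENNReal.ofReal_mul (by positivity)]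
          congr 1
          field_simp
  have hsplit (z : ℂ) :
      halfRieszPotential G z ≤ ENNReal.ofReal t + ENNReal.ofReal t + F z := by
    calc halfRieszPotential G z
        = ∫⁻ ζ, (G ζ * kf (dist ζ z) + Sᶜ.indicator G ζ * kn (dist ζ z)
            + S.indicator G ζ * kn (dist ζ z)) := by
          refine lintegral_congr fun ζ => ?_
          rw [add_assoc, ← add_mul, add_comm (Sᶜ.indicator G ζ), indicator_self_add_compl_apply,
            ← mul_add, add_comm, hkn, hkf, indicator_self_add_compl_apply]
      _ = (∫⁻ ζ, G ζ * kf (dist ζ z)) + (∫⁻ ζ, Sᶜ.indicator G ζ * kn (dist ζ z)) + F z := by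
          have hScG : Measurable (Sᶜ.indicator G) := hG.indicator hSm.compl
          rw [lintegral_add_left (by fun_prop), lintegral_add_left (by fun_prop)]
      _ ≤ _ := by gcongr; exacts [hfar z, hsmall z]
  have hFint : ∫⁻ z, F z ≤ ENNReal.ofReal (40 * N / t) * ∫⁻ ζ, S.indicator G ζ := by
    rw [hF, lintegral_lintegral_swap (by fun_prop), ← lintegral_const_mul _ hSG]
    refine lintegral_mono fun ζ => ?_
    rw [lintegral_const_mul _ (by fun_prop), mul_comm]
    gcongr
    simp_rw [dist_eq_norm]
    rwa [lintegral_sub_left_eq_self (fun x : ℂ => kn ‖x‖) ζ]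
  calc volume {z | ENNReal.ofReal (3 * t) < halfRieszPotential G z}
      ≤ volume {z | ENNReal.ofReal t ≤ F z} := by
        refine measure_mono fun z hz => ?_
        have h := (show _ < _ from hz).le.trans (hsplit z)
        rw [show 3 * t = t + t + t by ring, ENNReal.ofReal_add (by positivity) ht.le,
          ENNReal.ofReal_add ht.le ht.le] at h
        exact (ENNReal.add_le_add_iff_left (by finiteness)).1 h
    _ ≤ (∫⁻ z, F z) / ENNReal.ofReal t :=
        meas_ge_le_lintegral_div hFm.aemeasurable (by simpa using ht) ENNReal.ofReal_ne_top
    _ ≤ (ENNReal.ofReal (40 * N / t) * ∫⁻ ζ, S.indicator G ζ) / ENNReal.ofReal t := by gcongr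
    _ = ENNReal.ofReal (40 * N / t ^ 2) * ∫⁻ ζ, S.indicator G ζ := by
        rw [mul_comm, mul_div_assoc, ← ENNReal.ofReal_div_of_pos ht, mul_comm]
        congr 2
        field_simp

open Set Filter Topology in
lemma ae_halfRieszPotential_ne_top {G : ℂ → ENNReal} (hG : Measurable G) {N : ℝ}
    (hN : 0 < N) (hGN : ∫⁻ z, G z ^ 2 ≤ ENNReal.ofReal (N ^ 2)) :
    ∀ᵐ z, halfRieszPotential G z ≠ ⊤ := by
  have hbound (t : ℝ) (ht : 0 < t) : volume {z | halfRieszPotential G z = ⊤} ≤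
      ENNReal.ofReal ((40 * N / t ^ 2) ^ 2 * N ^ 2) := by
    calc _ ≤ volume {z | ENNReal.ofReal (3 * t) < halfRieszPotential G z} := by
          refine measure_mono fun z (hz : _ = _) => ?_
          rw [mem_ofPred_eq, hz]
          exact ENNReal.ofReal_lt_top
      _ ≤ _ := volume_lt_halfRieszPotential_le hG hN hGN ht
      _ ≤ ENNReal.ofReal (40 * N / t ^ 2) *
            (ENNReal.ofReal (40 * N / t ^ 2) * ENNReal.ofReal (N ^ 2)) := by
          gcongr
          refine le_trans ?_ (mul_le_mul_right hGN _)
          rw [← lintegral_const_mul _ (by fun_prop)]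
          refine lintegral_mono (indicator_le fun ζ hζ => ?_)
          have h : ENNReal.ofReal (t ^ 2 / (40 * N)) ≤ G ζ := (show _ < _ from hζ).le
          calc G ζ = ENNReal.ofReal (40 * N / t ^ 2) *
                (ENNReal.ofReal (t ^ 2 / (40 * N)) * G ζ) := by
                rw [← mul_assoc, ← ENNReal.ofReal_mul (by positivity),
                  div_mul_div_cancel₀ (by positivity), div_self (by positivity)]
                simp
            _ ≤ _ := by rw [sq (G ζ)]; gcongr
      _ = _ := by
          rw [← mul_assoc, ← ENNReal.ofReal_mul (by positivity),
            ← ENNReal.ofReal_mul (by positivity), sq (40 * N / t ^ 2)]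
  have hlim : Tendsto (fun t : ℝ => ENNReal.ofReal ((40 * N / t ^ 2) ^ 2 * N ^ 2)) atTop (𝓝 0) := by
    rw [← ENNReal.ofReal_zero]
    refine ENNReal.tendsto_ofReal ?_
    have h : Tendsto (fun t : ℝ => 40 * N / t ^ 2) atTop (𝓝 0) :=
      tendsto_const_nhds.div_atTop (tendsto_pow_atTop two_ne_zero)
    simpa using (h.pow 2).mul_const (N ^ 2)
  have h0 : volume {z | halfRieszPotential G z = ⊤} ≤ 0 :=
    ge_of_tendsto hlim ((eventually_gt_atTop 0).mono hbound)
  simpa [ae_iff] using h0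

open Set in
/-- The Hardy–Littlewood–Sobolev inequality `L² → L⁴` for the half-order Riesz potential
on `ℂ`. -/
lemma lintegral_halfRieszPotential_pow_four_le {g : ℂ → ℝ} (hg : Measurable g)
    (hg0 : ∀ z, 0 ≤ g z) {N : ℝ} (hN : 0 < N)
    (hgN : ∫⁻ z, ENNReal.ofReal (g z ^ 2) ≤ ENNReal.ofReal (N ^ 2)) :
    ∫⁻ z, halfRieszPotential (fun ζ => ENNReal.ofReal (g ζ)) z ^ 4 ≤
      ENNReal.ofReal ((720 * N ^ 2) ^ 2) := by
  set G : ℂ → ENNReal := fun ζ => ENNReal.ofReal (g ζ) with hGdef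
  have hG : Measurable G := by fun_prop
  have hGN : ∫⁻ z, G z ^ 2 ≤ ENNReal.ofReal (N ^ 2) := by
    simpa only [hGdef, ENNReal.ofReal_pow (hg0 _)] using hgN
  have hPm := measurable_halfRieszPotential hG
  set f : ℂ → ℝ := fun z => (halfRieszPotential G z).toReal / 3 with hf
  have hfm : Measurable f := by fun_prop
  have hf0 (z : ℂ) : 0 ≤ f z := by positivity
  have hPf : ∫⁻ z, halfRieszPotential G z ^ 4 =
      ENNReal.ofReal 81 * ∫⁻ z, ENNReal.ofReal (f z ^ (4 : ℝ)) := by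
    rw [← lintegral_const_mul _ (by fun_prop)]
    refine lintegral_congr_ae ?_
    filter_upwards [ae_halfRieszPotential_ne_top hG hN hGN] with z hz
    rw [← ENNReal.ofReal_mul (by norm_num)]
    nth_rewrite 1 [← ENNReal.ofReal_toReal hz]
    rw [← ENNReal.ofReal_pow ENNReal.toReal_nonneg]
    congr 1
    rw [show (4 : ℝ) = (4 : ℕ) by norm_num, Real.rpow_natCast, hf]
    ring
  set D : Set (ℝ × ℂ) := {p | p.1 < √(40 * N * g p.2)}
  set H : ℝ × ℂ → ENNReal := fun p => ENNReal.ofReal (40 * N * p.1 * g p.2) with hH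
  have hlevel (t : ℝ) (ht : 0 < t) :
      volume {z | t < f z} * ENNReal.ofReal (t ^ ((4 : ℝ) - 1)) ≤
        ∫⁻ ζ, D.indicator H (t, ζ) := by
    calc _ ≤ (ENNReal.ofReal (40 * N / t ^ 2) *
          ∫⁻ ζ, {ζ | ENNReal.ofReal (t ^ 2 / (40 * N)) < G ζ}.indicator G ζ) *
            ENNReal.ofReal (t ^ 3) := by
          rw [show (4 : ℝ) - 1 = (3 : ℕ) by norm_num, Real.rpow_natCast]
          gcongr
          refine le_trans (measure_mono fun z (hz : t < f z) => ?_)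
            (volume_lt_halfRieszPotential_le hG hN hGN ht)
          have h : 3 * t < (halfRieszPotential G z).toReal := by
            simp only [hf] at hz
            linarith
          exact (ENNReal.ofReal_lt_iff_lt_toReal (by positivity)
            (fun h' => by simp [h'] at h; linarith)).2 h
      _ = ∫⁻ ζ, ENNReal.ofReal (40 * N * t) *
            {ζ | ENNReal.ofReal (t ^ 2 / (40 * N)) < G ζ}.indicator G ζ := by
          rw [lintegral_const_mul _ (hG.indicator (measurableSet_lt measurable_const hG)),
            mul_right_comm, ← ENNReal.ofReal_mul (by positivity)]
          congr 2
          field_simp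
      _ = _ := by
          refine lintegral_congr fun ζ => ?_
          have hiff : ENNReal.ofReal (t ^ 2 / (40 * N)) < G ζ ↔ t < √(40 * N * g ζ) := by
            rw [hGdef, ENNReal.ofReal_lt_ofReal_iff_of_nonneg (by positivity),
              div_lt_iff₀ (by positivity), Real.lt_sqrt ht.le, mul_comm (g ζ)]
          by_cases h : t < √(40 * N * g ζ)
          · rw [indicator_of_mem (show ζ ∈ {ζ | _ < G ζ} from hiff.2 h),
              indicator_of_mem (show (t, ζ) ∈ D from h), hGdef, hH,
              ← ENNReal.ofReal_mul (by positivity)]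
          · rw [indicator_of_notMem (show ζ ∉ {ζ | _ < G ζ} from fun h' => h (hiff.1 h')),
              indicator_of_notMem (show (t, ζ) ∉ D from h), mul_zero]
  have hinner (ζ : ℂ) : ∫⁻ t in Ioi (0 : ℝ), D.indicator H (t, ζ) ≤
        ENNReal.ofReal ((40 * N) ^ 2) * ENNReal.ofReal (g ζ ^ 2) := by
    set s := √(40 * N * g ζ) with hs
    have hs2 : s * s = 40 * N * g ζ := Real.mul_self_sqrt (by have := hg0 ζ; positivity)
    have hs0 : 0 ≤ s := Real.sqrt_nonneg _
    calc _ ≤ ∫⁻ t in Ioi (0 : ℝ),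
          (Iio s).indicator (fun _ => ENNReal.ofReal (40 * N * s * g ζ)) t := by
          refine lintegral_mono fun t => ?_
          by_cases h : t < s
          · rw [indicator_of_mem (show (t, ζ) ∈ D from h),
              indicator_of_mem (show t ∈ Iio s from h)]
            have := hg0 ζ
            simp only [hH]
            gcongr
          · rw [indicator_of_notMem (show (t, ζ) ∉ D from h)]
            exact zero_le
      _ = ENNReal.ofReal ((40 * N) ^ 2) * ENNReal.ofReal (g ζ ^ 2) := by
          rw [lintegral_indicator measurableSet_Iio, Measure.restrict_restrict measurableSet_Iio,
            Iio_inter_Ioi, setLIntegral_const, Real.volume_Ioo, sub_zero,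
            ← ENNReal.ofReal_mul (by have := hg0 ζ; positivity),
            ← ENNReal.ofReal_mul (by positivity)]
          congr 1
          linear_combination 40 * N * g ζ * hs2
  calc _ = ENNReal.ofReal 81 * (ENNReal.ofReal 4 *
        ∫⁻ t in Ioi 0, volume {z | t < f z} * ENNReal.ofReal (t ^ ((4 : ℝ) - 1))) := by
        rw [hPf, lintegral_rpow_eq_lintegral_meas_lt_mul volume (ae_of_all _ hf0)
          hfm.aemeasurable (by norm_num)]
    _ ≤ ENNReal.ofReal 81 * (ENNReal.ofReal 4 *
        ∫⁻ t in Ioi (0 : ℝ), ∫⁻ ζ, D.indicator H (t, ζ)) := by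
        refine mul_le_mul_right (mul_le_mul_right ?_ _) _
        exact setLIntegral_mono' measurableSet_Ioi hlevel
    _ = ENNReal.ofReal 81 * (ENNReal.ofReal 4 *
        ∫⁻ ζ, ∫⁻ t in Ioi (0 : ℝ), D.indicator H (t, ζ)) := by
        rw [lintegral_lintegral_swap]
        refine Measurable.aemeasurable (Measurable.indicator (by fun_prop) ?_)
        exact measurableSet_lt (by fun_prop) (by fun_prop)
    _ ≤ ENNReal.ofReal 81 * (ENNReal.ofReal 4 *
        (ENNReal.ofReal ((40 * N) ^ 2) * ENNReal.ofReal (N ^ 2))) := by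
        refine mul_le_mul_right (mul_le_mul_right ?_ _) _
        refine le_trans (lintegral_mono hinner) ?_
        rw [lintegral_const_mul _ (by fun_prop)]
        gcongr
    _ = ENNReal.ofReal ((720 * N ^ 2) ^ 2) := by
        rw [← ENNReal.ofReal_mul (by positivity), ← ENNReal.ofReal_mul (by positivity),
          ← ENNReal.ofReal_mul (by positivity)]
        congr 1
        ring

/-- **Weighted bound for the half-order Riesz potential.**  There is a universal constant
`C > 0` such that for every measurable weight `V : ℂ → (0,∞)` with `V ∈ L²(ℂ)` and every
nonnegative `g ∈ L²(ℂ)`,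
`∫ (∫ g(ζ)/|ζ−z|^{3/2} dζ)² V(z) dz ≤ C² ‖V‖_{L²(ℂ)} ‖g‖²_{L²(ℂ)}`,
i.e. `‖I_{1/2} g‖_{L²_V(ℂ)} ≤ C ‖V‖_{L²(ℂ)}^{1/2} ‖g‖_{L²(ℂ)}`. -/
theorem weighted_bound_half_Riesz_potential :
    ∃ C : ℝ, 0 < C ∧
      ∀ (V g : ℂ → ℝ), Measurable V → (∀ z, 0 < V z) →
        (∫⁻ z, ENNReal.ofReal (V z ^ 2)) < ⊤ →
        Measurable g → (∀ z, 0 ≤ g z) →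
        (∫⁻ z, ENNReal.ofReal (g z ^ 2)) < ⊤ →
        ∫⁻ z, (∫⁻ ζ, ENNReal.ofReal (g ζ / dist ζ z ^ (3 / 2 : ℝ))) ^ 2 * ENNReal.ofReal (V z)
          ≤ ENNReal.ofReal (C ^ 2) * (∫⁻ z, ENNReal.ofReal (V z ^ 2)) ^ (1 / 2 : ℝ) *
              (∫⁻ z, ENNReal.ofReal (g z ^ 2)) := by
  refine ⟨27, by norm_num, fun V g hV hV0 _ hg hg0 hgfin => ?_⟩
  have hpot (z : ℂ) : ∫⁻ ζ, ENNReal.ofReal (g ζ / dist ζ z ^ (3 / 2 : ℝ)) =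
      halfRieszPotential (fun ζ => ENNReal.ofReal (g ζ)) z := by
    simp only [halfRieszPotential, halfRieszProfile, div_eq_mul_inv,
      ENNReal.ofReal_mul (hg0 _)]
  simp_rw [hpot]
  rcases eq_or_ne (∫⁻ z, ENNReal.ofReal (g z ^ 2)) 0 with h0 | h0
  · have hae : ∀ᵐ ζ, ENNReal.ofReal (g ζ) = 0 := by
      filter_upwards [(lintegral_eq_zero_iff (by fun_prop)).1 h0] with ζ hζ
      rw [ENNReal.ofReal_pow (hg0 ζ)] at hζ
      simpa using hζ
    have hz (z : ℂ) : halfRieszPotential (fun ζ => ENNReal.ofReal (g ζ)) z = 0 := by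
      rw [halfRieszPotential, lintegral_congr_ae (g := 0), lintegral_zero_fun]
      filter_upwards [hae] with ζ hζ
      simp [hζ]
    simp [hz]
  set A := (∫⁻ z, ENNReal.ofReal (g z ^ 2)).toReal with hA
  have hA0 : 0 < A := ENNReal.toReal_pos h0 hgfin.ne
  have hAeq : ∫⁻ z, ENNReal.ofReal (g z ^ 2) = ENNReal.ofReal A :=
    (ENNReal.ofReal_toReal hgfin.ne).symm
  have hfour := lintegral_halfRieszPotential_pow_four_le hg hg0 (Real.sqrt_pos.2 hA0)
    (by rw [Real.sq_sqrt hA0.le, hAeq])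
  rw [Real.sq_sqrt hA0.le] at hfour
  have hPm := measurable_halfRieszPotential (G := fun ζ => ENNReal.ofReal (g ζ)) (by fun_prop)
  refine (ENNReal.lintegral_mul_sq_le volume (hPm.pow_const 2).aemeasurable
    (by fun_prop)).trans ?_
  simp_rw [← pow_mul, ← ENNReal.ofReal_pow (hV0 _).le]
  have hroot : (∫⁻ z, halfRieszPotential (fun ζ => ENNReal.ofReal (g ζ)) z ^ (2 * 2)) ^
      (1 / 2 : ℝ) ≤ ENNReal.ofReal (27 ^ 2) * ENNReal.ofReal A := by
    refine (ENNReal.rpow_le_rpow hfour (by norm_num)).trans ?_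
    rw [ENNReal.ofReal_rpow_of_nonneg (by positivity) (by norm_num), ← Real.sqrt_eq_rpow,
      Real.sqrt_sq (by positivity), ← ENNReal.ofReal_mul (by positivity)]
    apply ENNReal.ofReal_le_ofReal
    linarith
  rw [hAeq, mul_right_comm]
  gcongr
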